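/- (Fundamental theorem of formal concept analysis.) Let φ : A → B → Prop be a relation between sets A and B, and let X be a complete lattice. Then X is order-isomorphic to the formal concept lattice Mφ if and only if there exist a join-dense map f : A → X and a meet-dense map g : B → X such that for all a ∈ A and b ∈ B one has φ a b ↔ f a ≤ g b. -/

import Mathlib

/-- `φ↑ U = {y | ∀ x ∈ U, φ x y}`. -/
def polarUp {A B : Type*} (φ : A → B → Prop) (U : Set A) : Set B := {y | ∀ x ∈ U, φ x y}

/-- `φ↓ V = {x | ∀ y ∈ V, φ x y}`. -/
def polarDown {A B : Type*} (φ : A → B → Prop) (V : Set B) : Set A := {x | ∀ y ∈ V, φ x y}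

/-- A map `f : A → X` into a complete lattice is join-dense if every element of `X`
is a supremum of images of a subset of `A`. -/
def JoinDense {A X : Type*} [CompleteLattice X] (f : A → X) : Prop :=
  ∀ x : X, ∃ S : Set A, x = ⨆ a ∈ S, f a

/-- A map `g : B → X` into a complete lattice is meet-dense if every element of `X`
is an infimum of images of a subset of `B`. -/
def MeetDense {B X : Type*} [CompleteLattice X] (g : B → X) : Prop :=
  ∀ x : X, ∃ S : Set B, x = ⨅ b ∈ S, g b

theorem mem_polarDown_polarUp {A B : Type*} {φ : A → B → Prop} {U : Set A} {a : A} (h : a ∈ U) :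
    a ∈ polarDown φ (polarUp φ U) :=
  fun _ hb => hb a h

theorem polarDown_polarUp_mono {A B : Type*} {φ : A → B → Prop} {U V : Set A} (h : U ⊆ V) :
    polarDown φ (polarUp φ U) ⊆ polarDown φ (polarUp φ V) :=
  fun _ ha b hb => ha b fun x hx => hb x (h hx)

theorem polarDown_polarUp_polarDown {A B : Type*} (φ : A → B → Prop) (V : Set B) :
    polarDown φ (polarUp φ (polarDown φ V)) = polarDown φ V :=
  Set.Subset.antisymm (fun _ ha b hb => ha b fun _ hx => hx b hb)
    fun _ => mem_polarDown_polarUp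

/-- An element is determined from below by the members of a join-dense family. -/
theorem JoinDense.le_iff {A X : Type*} [CompleteLattice X] {f : A → X} (hf : JoinDense f)
    {x y : X} : x ≤ y ↔ ∀ a, f a ≤ x → f a ≤ y := by
  refine ⟨fun h a ha => ha.trans h, fun h => ?_⟩
  obtain ⟨S, rfl⟩ := hf x
  exact iSup₂_le fun a ha => h a (le_iSup₂ (f := fun a (_ : a ∈ S) => f a) a ha)

/-- An element is determined from above by the members of a meet-dense family. -/
theorem MeetDense.le_iff {B X : Type*} [CompleteLattice X] {g : B → X} (hg : MeetDense g)
    {x y : X} : x ≤ y ↔ ∀ b, y ≤ g b → x ≤ g b := by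
  refine ⟨fun h b hb => h.trans hb, fun h => ?_⟩
  obtain ⟨S, rfl⟩ := hg y
  exact le_iInf₂ fun b hb => h b (iInf₂_le (f := fun b (_ : b ∈ S) => g b) b hb)

/-- A complete lattice with compatible join-dense and meet-dense maps is isomorphic to the
formal concept lattice, via `x ↦ {a | f a ≤ x}`. -/
def conceptOrderIso {A B X : Type*} [CompleteLattice X] {φ : A → B → Prop} {f : A → X}
    {g : B → X} (hf : JoinDense f) (hg : MeetDense g) (h : ∀ a b, φ a b ↔ f a ≤ g b) :
    X ≃o {U : Set A // polarDown φ (polarUp φ U) = U} where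
  toFun x := ⟨{a | f a ≤ x}, Set.Subset.antisymm
    (fun a ha => hg.le_iff.2 fun b hb =>
      (h a b).1 (ha b fun a' ha' => (h a' b).2 (le_trans ha' hb)))
    fun _ => mem_polarDown_polarUp⟩
  invFun U := ⨆ a ∈ U.1, f a
  left_inv x := le_antisymm (iSup₂_le fun _ ha => ha)
    (hf.le_iff.2 fun a ha => le_iSup₂ (f := fun a (_ : a ∈ {a | f a ≤ x}) => f a) a ha)
  right_inv U := by
    refine Subtype.ext (Set.Subset.antisymm (fun a ha => ?_) fun a ha =>
      le_iSup₂ (f := fun a (_ : a ∈ U.1) => f a) a ha)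
    rw [← U.2]
    exact fun b hb => (h a b).2 (le_trans ha (iSup₂_le fun a' ha' => (h a' b).1 (hb a' ha')))
  map_rel_iff' := hf.le_iff.symm

/-- A complete lattice isomorphic to the formal concept lattice carries compatible join-dense
and meet-dense maps. -/
theorem exists_joinDense_meetDense_of_orderIso {A B X : Type*} [CompleteLattice X]
    {φ : A → B → Prop} (e : X ≃o {U : Set A // polarDown φ (polarUp φ U) = U}) :
    ∃ (f : A → X) (g : B → X), JoinDense f ∧ MeetDense g ∧
      ∀ (a : A) (b : B), φ a b ↔ f a ≤ g b := by
  let f : A → X := fun a =>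
    e.symm ⟨polarDown φ (polarUp φ {a}), polarDown_polarUp_polarDown φ _⟩
  let g : B → X := fun b => e.symm ⟨polarDown φ {b}, polarDown_polarUp_polarDown φ _⟩
  have hf : ∀ a x, f a ≤ x ↔ a ∈ (e x).1 := by
    intro a x
    refine (e.symm_apply_le).trans ⟨fun h => h (mem_polarDown_polarUp rfl), fun h => ?_⟩
    change polarDown φ (polarUp φ {a}) ⊆ (e x).1
    rw [← (e x).2]
    exact polarDown_polarUp_mono (Set.singleton_subset_iff.2 h)
  have hg : ∀ x b, x ≤ g b ↔ b ∈ polarUp φ (e x).1 := by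
    intro x b
    refine (e.le_symm_apply).trans ⟨fun h a ha => h ha b rfl, fun h a ha b' hb' => ?_⟩
    obtain rfl : b' = b := hb'
    exact h a ha
  refine ⟨f, g, fun x => ⟨(e x).1, le_antisymm ?_ (iSup₂_le fun a ha => (hf a x).2 ha)⟩,
    fun x => ⟨polarUp φ (e x).1, le_antisymm (le_iInf₂ fun b hb => (hg x b).2 hb) ?_⟩,
    fun a b => ?_⟩
  · exact e.le_iff_le.1 fun a ha =>
      (hf a _).1 (le_iSup₂ (f := fun a (_ : a ∈ (e x).1) => f a) a ha)
  · refine e.le_iff_le.1 fun a ha => ?_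
    rw [← (e x).2]
    exact fun b hb =>
      (hg _ b).1 (iInf₂_le (f := fun b (_ : b ∈ polarUp φ (e x).1) => g b) b hb) a ha
  · rw [hf, e.apply_symm_apply]
    exact ⟨fun h b' hb' => by obtain rfl : b' = b := hb'; exact h, fun h => h b rfl⟩

/-- fundamental theorem of FCA: a complete lattice `X` is
order-isomorphic to the formal concept lattice `Mφ` iff there exist a join-dense
map `f : A → X` and a meet-dense map `g : B → X` with `φ a b ↔ f a ≤ g b`. -/
theorem stmt2 {A B X : Type*} [CompleteLattice X] (φ : A → B → Prop) :
    Nonempty (X ≃o {U : Set A // polarDown φ (polarUp φ U) = U}) ↔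
      ∃ (f : A → X) (g : B → X), JoinDense f ∧ MeetDense g ∧
        ∀ (a : A) (b : B), φ a b ↔ f a ≤ g b := by
  exact ⟨fun ⟨e⟩ => exists_joinDense_meetDense_of_orderIso e,
    fun ⟨_, _, hf, hg, h⟩ => ⟨conceptOrderIso hf hg h⟩⟩
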